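/- Let f : X → Y be a proper surjective morphism of schemes of finite type over ℂ, where the underlying topological spaces of X and Y are irreducible. Then there exists a closed irreducible subset Z of the underlying space of X such that the image of Z under f is all of Y and the topological Krull dimension of Z (with its subspace topology) equals the topological Krull dimension of the underlying space of Y. -/

import Mathlib

open AlgebraicGeometry CategoryTheory

open TopologicalSpace in
/-- A closed continuous surjection from a quasi-sober space does not raise the dimension. -/
theorem IsClosedMap.topologicalKrullDim_le_of_surjective {S T : Type*} [TopologicalSpace S]
    [TopologicalSpace T] [QuasiSober T] {f : S → T} (hf : IsClosedMap f) (hc : Continuous f)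
    (hs : Function.Surjective f) : topologicalKrullDim T ≤ topologicalKrullDim S := by
  have key (n : ℕ) : ∀ (D : IrreducibleCloseds T) (E : IrreducibleCloseds S),
      f '' E = D → n ≤ Order.height D → n ≤ Order.height E := by
    induction n with
    | zero => simp
    | succ n ih =>
      intro D E hED hn
      obtain ⟨p, hp, hlen⟩ := Order.exists_series_of_le_height D hn
      have hlt : p.eraseLast.last < D :=
        hp ▸ p.eraseLast_last_rel_last (by omega)
      have hDn : n ≤ Order.height p.eraseLast.last := by
        simpa [hlen] using Order.length_le_height_last (p := p.eraseLast)
      set D' := p.eraseLast.last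
      obtain ⟨d, hd⟩ := QuasiSober.sober D'.isIrreducible D'.isClosed
      have hdD : d ∈ (D : Set T) := hlt.le (hd ▸ subset_closure rfl : d ∈ (D' : Set T))
      obtain ⟨e, he, rfl⟩ := hED ▸ hdD
      let E' : IrreducibleCloseds S := ⟨closure {e}, isIrreducible_singleton.closure, isClosed_closure⟩
      have hE' : f '' E' = D' := by
        rw [← hd, ← Set.image_singleton]
        exact (hf.closure_image_eq_of_continuous hc _).symm
      have hle : E' ≤ E := E.isClosed.closure_subset_iff.2 (by simpa using he)
      have hne : E' < E := lt_of_le_of_ne hle fun h ↦ hlt.ne <| by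
        apply SetLike.coe_injective
        rw [← hE', ← hED, h]
      calc ((n + 1 : ℕ) : ℕ∞) = n + 1 := by simp
        _ ≤ Order.height E' + 1 := by gcongr; exact ih D' E' hE' hDn
        _ ≤ Order.height E := Order.height_add_one_le hne
  rw [topologicalKrullDim, Order.krullDim_eq_iSup_height]
  refine iSup_le fun D ↦ ?_
  obtain ⟨d, hd⟩ := QuasiSober.sober D.isIrreducible D.isClosed
  obtain ⟨e, rfl⟩ := hs d
  let E : IrreducibleCloseds S := ⟨closure {e}, isIrreducible_singleton.closure, isClosed_closure⟩
  have hE : f '' E = D := by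
    rw [← hd, ← Set.image_singleton]
    exact (hf.closure_image_eq_of_continuous hc _).symm
  refine le_trans (WithBot.coe_le_coe.2 ?_) (Order.height_le_krullDim E)
  exact ENat.forall_natCast_le_iff_le.1 fun n hn ↦ key n D E hE hn

/-- The dimension of a space is bounded by the dimensions of the members of an open cover. -/
theorem topologicalKrullDim_le_of_forall_isOpenEmbedding {T : Type*} [TopologicalSpace T]
    {d : WithBot ℕ∞} {ι : Type*} {U : ι → Type*} [∀ i, TopologicalSpace (U i)]
    (j : ∀ i, U i → T) (hj : ∀ i, Topology.IsOpenEmbedding (j i))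
    (hcov : ∀ t, ∃ i, t ∈ Set.range (j i)) (hd : ∀ i, topologicalKrullDim (U i) ≤ d) :
    topologicalKrullDim T ≤ d := by
  rw [topologicalKrullDim, Order.krullDim_eq_iSup_coheight]
  refine iSup_le fun D ↦ ?_
  obtain ⟨t, ht⟩ := D.isIrreducible.nonempty
  obtain ⟨i, u, rfl⟩ := hcov t
  let e := TopologicalSpace.IrreducibleCloseds.orderIsoOfIsOpenEmbedding (j i) (hj i)
  have h := (hj i).coheight_map (e.symm ⟨D, u, ht⟩)
  have h' : TopologicalSpace.IrreducibleCloseds.map (j i) (hj i).continuous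
      (e.symm ⟨D, u, ht⟩) = D := congrArg Subtype.val (e.apply_symm_apply ⟨D, u, ht⟩)
  rw [h'] at h
  rw [h]
  exact (Order.coheight_le_krullDim _).trans (hd i)

theorem ringKrullDim_eq_of_isIntegral_of_injective {R S : Type*} [CommRing R] [CommRing S]
    {f : R →+* S} (hf : f.IsIntegral) (hinj : Function.Injective f) :
    ringKrullDim R = ringKrullDim S := by
  apply le_antisymm
  · rw [← PrimeSpectrum.topologicalKrullDim_eq_ringKrullDim,
      ← PrimeSpectrum.topologicalKrullDim_eq_ringKrullDim]
    refine (PrimeSpectrum.isClosedMap_comap_of_isIntegral f hf).topologicalKrullDim_le_of_surjective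
      (PrimeSpectrum.continuous_comap f) ?_
    exact hf.comap_surjective hinj
  · algebraize [f]
    refine Order.krullDim_le_of_strictMono (PrimeSpectrum.comap f) fun p q hpq ↦ ?_
    exact Ideal.IsIntegral.comap_lt_comap (R := R) (I := p.asIdeal) (J := q.asIdeal) hpq

/-- The dimension of a finitely generated domain over a field is its transcendence degree. -/
theorem ringKrullDim_eq_trdeg (k R : Type*) [Field k] [CommRing R] [IsDomain R] [Algebra k R]
    [Algebra.FiniteType k R] : ringKrullDim R = (Algebra.trdeg k R).toNat := by
  obtain ⟨s, g, hg, hint⟩ := exists_integral_inj_algHom_of_fg k R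
  rw [← ringKrullDim_eq_of_isIntegral_of_injective hint hg,
    MvPolynomial.ringKrullDim_of_isNoetherianRing, ringKrullDim_eq_zero_of_field, zero_add,
    Nat.card_fin]
  algebraize [g.toRingHom]
  have : IsScalarTower k (MvPolynomial (Fin s) k) R := .of_algebraMap_eq fun x ↦ (g.commutes x).symm
  have : FaithfulSMul (MvPolynomial (Fin s) k) R := (faithfulSMul_iff_algebraMap_injective _ _).2 hg
  have h := congrArg Cardinal.toNat (lift_trdeg_add_eq k (MvPolynomial (Fin s) k) R)
  rw [MvPolynomial.trdeg_of_isDomain,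
    trdeg_eq_zero (R := MvPolynomial (Fin s) k) (A := R)] at h
  simp only [Cardinal.lift_zero, add_zero, Cardinal.toNat_lift, Cardinal.mk_fin,
    Cardinal.toNat_natCast] at h
  rw [h]

/-- Let `A ⊆ B` be domains with `B` finitely generated over `A`, such that the zero ideal of `B` is
the only prime lying over the zero ideal of `A`. Then `B` is algebraic over `A`. -/
theorem Algebra.IsAlgebraic.of_forall_comap_eq_bot.{u} {A B : Type u} [CommRing A] [IsDomain A]
    [CommRing B] [IsDomain B] [Algebra A B] [FaithfulSMul A B] [Algebra.FiniteType A B]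
    (h : ∀ p : Ideal B, p.IsPrime → p.comap (algebraMap A B) = ⊥ → p = ⊥) :
    Algebra.IsAlgebraic A B := by
  let S := Algebra.algebraMapSubmonoid B (nonZeroDivisors A)
  let K := FractionRing A
  let L := Localization S
  have hS : S ≤ nonZeroDivisors B := by
    rintro _ ⟨a, ha, rfl⟩
    refine mem_nonZeroDivisors_of_ne_zero fun h0 ↦ nonZeroDivisors.ne_zero ha ?_
    exact FaithfulSMul.algebraMap_injective A B (h0.trans (map_zero _).symm)
  have : IsDomain L := IsLocalization.isDomain_localization hS
  have hBL : Function.Injective (algebraMap B L) := IsLocalization.injective L hS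
  have hL : IsField L := by
    by_contra hL
    obtain ⟨p, hp, hprime⟩ := Ring.not_isField_iff_exists_prime.1 hL
    apply hp
    obtain ⟨hq, hdisj⟩ := (IsLocalization.isPrime_iff_isPrime_disjoint S L p).1 hprime
    have hbot : p.under B = ⊥ := h _ hq <| by
      refine (Submodule.eq_bot_iff _).2 fun a ha ↦ by_contra fun ha0 ↦ ?_
      exact Set.disjoint_left.1 hdisj ⟨a, mem_nonZeroDivisors_of_ne_zero ha0, rfl⟩ ha
    rw [← IsLocalization.map_under S L p, hbot, Ideal.map_bot]
  let : Field L := hL.toField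
  have : IsLocalization ((nonZeroDivisors A).map (algebraMap A B)) L :=
    inferInstanceAs (IsLocalization S L)
  have hfin : (algebraMap K L).FiniteType :=
    RingHom.finiteType_localizationPreserves (algebraMap A B) (nonZeroDivisors A) K L
      (RingHom.finiteType_algebraMap.2 inferInstance)
  have : Algebra.FiniteType K L := RingHom.finiteType_algebraMap.1 hfin
  have : Module.Finite K L := finite_of_finite_type_of_isJacobsonRing K L
  have : Algebra.IsAlgebraic A L :=
    (IsFractionRing.comap_isAlgebraic_iff (K := K)).2 inferInstance
  exact .of_injective (IsScalarTower.toAlgHom A B L) hBL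

/-- Let `A ⊆ B` be finitely generated domains over a field such that the zero ideal of `B` is the
only prime lying over the zero ideal of `A`. Then `A` and `B` have the same dimension. -/
theorem ringKrullDim_eq_of_forall_eq_bot.{u} (k : Type*) {A B : Type u} [Field k] [CommRing A]
    [IsDomain A] [CommRing B] [IsDomain B] [Algebra k A] [Algebra k B] [Algebra A B]
    [IsScalarTower k A B] [FaithfulSMul A B] [Algebra.FiniteType k A] [Algebra.FiniteType k B]
    (h : ∀ p : Ideal B, p.IsPrime → p.comap (algebraMap A B) = ⊥ → p = ⊥) :
    ringKrullDim B = ringKrullDim A := by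
  have : Algebra.FiniteType A B := .of_restrictScalars_finiteType k A B
  have : Algebra.IsAlgebraic A B := .of_forall_comap_eq_bot h
  rw [ringKrullDim_eq_trdeg k, ringKrullDim_eq_trdeg k]
  have h := congrArg Cardinal.toNat (lift_trdeg_add_eq k A B)
  rw [trdeg_eq_zero (R := A) (A := B)] at h
  simp only [Cardinal.lift_zero, add_zero, Cardinal.toNat_lift] at h
  rw [h]

/-- If `p` is maximal among the primes of `B` lying over its contraction `q` to `A`, then
`dim B ⧸ p ≤ dim A`, for algebras of finite type over a field. -/
theorem ringKrullDim_quotient_le_of_forall_eq.{u} {k : Type*} {A B : Type u} [Field k]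
    [CommRing A] [CommRing B] {φ : k →+* A} {ψ : A →+* B} (hφ : φ.FiniteType)
    (hψ : ψ.FiniteType) (p : Ideal B) [p.IsPrime]
    (h : ∀ p' : Ideal B, p'.IsPrime → p ≤ p' → p'.comap ψ = p.comap ψ → p' = p) :
    ringKrullDim (B ⧸ p) ≤ ringKrullDim A := by
  have hcomp := hψ.comp hφ
  algebraize [φ, ψ, ψ.comp φ]
  let q := p.comap (algebraMap A B)
  have : FaithfulSMul (A ⧸ q) (B ⧸ p) :=
    (faithfulSMul_iff_algebraMap_injective _ _).2 (Ideal.algebraMap_quotient_injective)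
  have : IsScalarTower k (A ⧸ q) (B ⧸ p) := .of_algebraMap_eq fun x ↦ rfl
  refine (ringKrullDim_eq_of_forall_eq_bot k (A := A ⧸ q) fun P hP hPbot ↦ ?_).trans_le
    (ringKrullDim_quotient_le q)
  have hle : p ≤ P.comap (Ideal.Quotient.mk p) := fun b hb ↦ by
    simp [Ideal.Quotient.eq_zero_iff_mem.2 hb]
  have := h (P.comap (Ideal.Quotient.mk p)) inferInstance hle <| by
    refine le_antisymm (fun a ha ↦ ?_) (Ideal.comap_mono hle)
    have : Ideal.Quotient.mk q a ∈ P.comap (algebraMap (A ⧸ q) (B ⧸ p)) := ha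
    rw [hPbot] at this
    exact Ideal.Quotient.eq_zero_iff_mem.1 this
  rw [← Ideal.map_comap_of_surjective _ Ideal.Quotient.mk_surjective P, this, Ideal.map_quotient_self]

/-- Let `f : X ⟶ Y` be a morphism of schemes locally of finite type over a field, and let `x` be a
point without proper specializations in its fiber. Then `dim (closure {x}) ≤ dim Y`. -/
theorem AlgebraicGeometry.topologicalKrullDim_closure_singleton_le.{u} {k : Type u} [Field k]
    {X Y : Scheme.{u}} (sY : Y ⟶ Spec (.of k)) [LocallyOfFiniteType sY] (f : X ⟶ Y)
    [LocallyOfFiniteType f] (x : X) (hx : ∀ x' : X, x ⤳ x' → f x' = f x → x' ⤳ x) :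
    topologicalKrullDim (closure {x} : Set X) ≤ topologicalKrullDim Y := by
  have hloc (z : (closure {x} : Set X)) : ∃ (R : Type u) (_ : CommRing R)
      (j : PrimeSpectrum R → (closure {x} : Set X)), Topology.IsOpenEmbedding j ∧
        z ∈ Set.range j ∧ ringKrullDim R ≤ topologicalKrullDim Y := by
    obtain ⟨V, hV, hzV, -⟩ := exists_isAffineOpen_mem_and_subset
      (TopologicalSpace.Opens.mem_top (f z))
    obtain ⟨U, hU, hzU, hUV⟩ := exists_isAffineOpen_mem_and_subset (U := f ⁻¹ᵁ V) (x := z.1) hzV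
    have hxU : x ∈ U := (specializes_iff_mem_closure.2 z.2).mem_open U.isOpen hzU
    let i : PrimeSpectrum Γ(X, U) → X := hU.fromSpec
    have hi : Set.range i = U := hU.range_fromSpec
    obtain ⟨p, hp⟩ : x ∈ Set.range i := hi ▸ hxU
    have hemb : Topology.IsOpenEmbedding i := hU.fromSpec.isOpenEmbedding
    have hspec (p₁ p₂ : PrimeSpectrum Γ(X, U)) :
        i p₁ ⤳ i p₂ ↔ p₁.asIdeal ≤ p₂.asIdeal :=
      hemb.isInducing.specializes_iff.trans (PrimeSpectrum.le_iff_specializes p₁ p₂).symm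
    let π := Ideal.Quotient.mk p.asIdeal
    have hπ := PrimeSpectrum.isClosedEmbedding_comap_of_surjective _ π Ideal.Quotient.mk_surjective
    have hrange : Set.range (i ∘ PrimeSpectrum.comap π) = closure {x} ∩ U := by
      rw [Set.range_comp, range_comap_of_surjective _ π
        Ideal.Quotient.mk_surjective, Ideal.mk_ker]
      ext y
      constructor
      · rintro ⟨p', hp', rfl⟩
        refine ⟨?_, hi ▸ Set.mem_range_self p'⟩
        exact specializes_iff_mem_closure.1 (hp ▸ (hspec p p').2 hp')
      · rintro ⟨hy, hyU⟩
        obtain ⟨p', rfl⟩ : y ∈ Set.range i := hi ▸ hyU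
        exact ⟨p', (hspec p p').1 (hp ▸ specializes_iff_mem_closure.2 hy), rfl⟩
    have hmem (t) : (i ∘ PrimeSpectrum.comap π) t ∈ closure {x} :=
      (hrange ▸ Set.mem_range_self t : _ ∈ closure {x} ∩ (U : Set X)).1
    refine ⟨Γ(X, U) ⧸ p.asIdeal, inferInstance, Set.codRestrict _ _ hmem, ⟨?_, ?_⟩, ?_, ?_⟩
    · exact (hemb.isEmbedding.comp hπ.isEmbedding).codRestrict _ _
    · convert! U.isOpen.preimage continuous_subtype_val using 1
      ext y
      have := Set.ext_iff.1 hrange y.1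
      simpa [Subtype.ext_iff] using this
    · obtain ⟨t, ht⟩ : z.1 ∈ Set.range (i ∘ PrimeSpectrum.comap π) := by
        rw [hrange]
        exact ⟨z.2, hzU⟩
      exact ⟨t, Subtype.ext ht⟩
    · have hA : ((Scheme.ΓSpecIso (.of k)).inv ≫ sY.appLE ⊤ V le_top).hom.FiniteType :=
        (sY.finiteType_appLE (isAffineOpen_top _) hV le_top).comp
          (.of_surjective _ (Scheme.ΓSpecIso (.of k)).symm.commRingCatIsoToRingEquiv.surjective)
      have hB := f.finiteType_appLE hV hU hUV
      have hcomm (p' : PrimeSpectrum Γ(X, U)) :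
          hV.fromSpec (PrimeSpectrum.comap (f.appLE V U hUV).hom p') = f (i p') :=
        congrArg (fun g : Spec Γ(X, U) ⟶ Y ↦ g p') (hV.SpecMap_appLE_fromSpec f hU hUV)
      refine (ringKrullDim_quotient_le_of_forall_eq hA hB p.asIdeal fun p' hp' hle heq ↦ ?_).trans ?_
      · have hf : f (i ⟨p', hp'⟩) = f (i p) := by
          rw [← hcomm, ← hcomm]
          exact congrArg _ (PrimeSpectrum.ext heq)
        rw [hp] at hf
        have := hx _ (hp ▸ (hspec p ⟨p', hp'⟩).2 hle) hf
        exact le_antisymm ((hspec ⟨p', hp'⟩ p).1 (hp ▸ this)) hle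
      · rw [← PrimeSpectrum.topologicalKrullDim_eq_ringKrullDim]
        exact hV.fromSpec.isOpenEmbedding.isInducing.topologicalKrullDim_le
  choose R _ j hj hzj hR using hloc
  exact topologicalKrullDim_le_of_forall_isOpenEmbedding j hj (fun z ↦ ⟨z, hzj z⟩) fun z ↦
    (PrimeSpectrum.topologicalKrullDim_eq_ringKrullDim (R := R z)).trans_le (hR z)

open TopologicalSpace in
/-- A closed surjection from a Noetherian space onto an irreducible sober space is surjective on
the closure of a point having no proper specialization in its fiber. -/
theorem IsClosedMap.exists_image_closure_singleton_eq_univ {S T : Type*} [TopologicalSpace S]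
    [NoetherianSpace S] [TopologicalSpace T] [QuasiSober T] [IrreducibleSpace T] {f : S → T}
    (hf : IsClosedMap f) (hc : Continuous f) (hs : Function.Surjective f) :
    ∃ x, f '' closure {x} = Set.univ ∧ ∀ x', x ⤳ x' → f x' = f x → x' ⤳ x := by
  have himage (s : S) : f '' closure {s} = closure {f s} := by
    rw [← Set.image_singleton, hf.closure_image_eq_of_continuous hc]
  obtain ⟨Z, hZ⟩ := exists_minimal_of_wellFoundedLT (fun Z : Closeds S ↦ f '' Z = Set.univ)
    ⟨⊤, by simpa using hs.range_eq⟩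
  obtain ⟨x, hxZ, hx⟩ : genericPoint T ∈ f '' Z := hZ.prop ▸ Set.mem_univ _
  have huniv (s : S) (h : f s = genericPoint T) : f '' closure {s} = Set.univ := by
    rw [himage, h, genericPoint_closure]
  refine ⟨x, huniv x hx, fun x' hxx' hx' ↦ ?_⟩
  have hle : Closeds.closure {x'} ≤ Z := by
    refine Z.isClosed.closure_subset_iff.2 (Set.singleton_subset_iff.2 ?_)
    exact hxx'.mem_closed Z.isClosed hxZ
  exact specializes_iff_mem_closure.2 (hZ.le_of_le (huniv x' (hx'.trans hx)) hle hxZ)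

/-- Let `f : X → Y` be a proper surjective morphism of schemes of finite type over `ℂ` with
`X` and `Y` irreducible. Then there is a closed irreducible subset `Z ⊆ X` with `f(Z) = Y`
and whose topological Krull dimension equals that of `Y`. -/
theorem exists_closed_irreducible_surjecting_of_dim_eq
    (X Y : Scheme) (sX : X ⟶ Spec (CommRingCat.of ℂ)) (sY : Y ⟶ Spec (CommRingCat.of ℂ))
    (hXlft : LocallyOfFiniteType sX) (hXqc : QuasiCompact sX)
    (hYlft : LocallyOfFiniteType sY) (hYqc : QuasiCompact sY)
    (f : X ⟶ Y) (hf : f ≫ sY = sX)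
    (hproper : IsProper f) (hsurj : Function.Surjective f.base)
    (hXirr : IrreducibleSpace X) (hYirr : IrreducibleSpace Y) :
    ∃ Z : Set X, IsClosed Z ∧ IsIrreducible Z ∧ f.base '' Z = Set.univ ∧
      topologicalKrullDim Z = topologicalKrullDim Y := by
  have : IsNoetherian X :=
    { toIsLocallyNoetherian := LocallyOfFiniteType.isLocallyNoetherian sX
      toCompactSpace := QuasiCompact.compactSpace_of_compactSpace sX }
  obtain ⟨x, hx, hmax⟩ :=
    f.isClosedMap.exists_image_closure_singleton_eq_univ f.continuous hsurj
  refine ⟨closure {x}, isClosed_closure, isIrreducible_singleton.closure, hx, le_antisymm ?_ ?_⟩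
  · exact topologicalKrullDim_closure_singleton_le sY f x hmax
  · refine (f.isClosedMap.comp
      isClosed_closure.isClosedMap_subtype_val).topologicalKrullDim_le_of_surjective
      (f.continuous.comp continuous_subtype_val) fun y ↦ ?_
    obtain ⟨z, hz, rfl⟩ := hx ▸ Set.mem_univ y
    exact ⟨⟨z, hz⟩, rfl⟩
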